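/- arXiv:1711.05543 — 5 statements merged into one kernel-verified Lean document; each statement's English description precedes it below -/
import Mathlib

section
/- Fix real numbers ρ, σ, z, integers m, n with n ≠ 0, and a positive integer K, and let T_{ρ,σ}(y,z) = (y+ρ, z+y+σ) and e_{m,n}(y,z) = exp(2πi(my + Knz)). Then the functions y ↦ e_{m,n}(T_{ρ,σ}^j(y,z)), indexed by natural numbers j, form an orthonormal system in L²([0,1], dy): for all j, j', ∫_0^1 e_{m,n}(T_{ρ,σ}^j(y,z)) · conj(e_{m,n}(T_{ρ,σ}^{j'}(y,z))) dy equals 1 if j = j' and 0 otherwise. -/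
theorem exists_iterate_skewShift_eq {T : ℝ × ℝ → ℝ × ℝ} {ρ σ : ℝ}
    (hT : ∀ y z : ℝ, T (y, z) = (y + ρ, z + y + σ)) (z : ℝ) (j : ℕ) :
    ∃ c : ℝ, ∀ y : ℝ, T^[j] (y, z) = (y + j * ρ, j * y + c) := by
  induction j with
  | zero => exact ⟨z, fun y => by simp⟩
  | succ j ih =>
    obtain ⟨c, hc⟩ := ih
    refine ⟨c + j * ρ + σ, fun y => ?_⟩
    rw [Function.iterate_succ_apply', hc, hT]
    ext <;> push_cast <;> ring

theorem integral_exp_two_pi_I_int_mul_eq_zero {k : ℤ} (hk : k ≠ 0) :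
    ∫ y in (0:ℝ)..1, Complex.exp (2 * (Real.pi : ℂ) * Complex.I * k * y) = 0 := by
  have hc : 2 * (Real.pi : ℂ) * Complex.I * k ≠ 0 :=
    mul_ne_zero Complex.two_pi_I_ne_zero (Int.cast_ne_zero.mpr hk)
  have h1 : Complex.exp (2 * (Real.pi : ℂ) * Complex.I * k) = 1 := by
    rw [mul_comm]
    exact Complex.exp_int_mul_two_pi_mul_I k
  rw [integral_exp_mul_complex hc]
  simp [h1]


/-- Orthonormality in `L²([0,1], dy)` of the functions `y ↦ e_{m,n}(T_{ρ,σ}^j(y,z))`,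
for `n ≠ 0`. -/
theorem stmt6 (ρ σ z : ℝ) (m n : ℤ) (hn : n ≠ 0) (K : ℕ) (hK : 0 < K)
    (T : ℝ × ℝ → ℝ × ℝ) (hT : ∀ y' z' : ℝ, T (y', z') = (y' + ρ, z' + y' + σ))
    (e : ℤ → ℤ → ℝ × ℝ → ℂ)
    (he : ∀ (m' n' : ℤ) (y' z' : ℝ),
      e m' n' (y', z') =
        Complex.exp (2 * (Real.pi : ℂ) * Complex.I *
          ((m' : ℂ) * (y' : ℂ) + (K : ℂ) * (n' : ℂ) * (z' : ℂ)))) :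
    ∀ j j' : ℕ,
      (∫ y in (0:ℝ)..1, e m n (T^[j] (y, z)) * (starRingEnd ℂ) (e m n (T^[j'] (y, z)))) =
        if j = j' then 1 else 0 := by
  intro j j'
  obtain ⟨c, hc⟩ := exists_iterate_skewShift_eq hT z j
  obtain ⟨c', hc'⟩ := exists_iterate_skewShift_eq hT z j'
  have key : ∀ y : ℝ, e m n (T^[j] (y, z)) * (starRingEnd ℂ) (e m n (T^[j'] (y, z))) =
      Complex.exp (2 * (Real.pi : ℂ) * Complex.I *
        (m * ((j - j') * ρ) + K * n * (c - c'))) *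
      Complex.exp (2 * (Real.pi : ℂ) * Complex.I * ((K * n * (j - j') : ℤ) : ℂ) * y) := by
    intro y
    rw [hc, hc', he, he, ← Complex.exp_conj, ← Complex.exp_add, ← Complex.exp_add]
    congr 1
    simp only [map_mul, map_add, Complex.conj_ofReal, Complex.conj_I, map_ofNat, map_intCast,
      map_natCast]
    push_cast
    ring
  simp_rw [key]
  rw [intervalIntegral.integral_const_mul]
  split_ifs with h
  · subst h
    obtain rfl : c = c' := by
      simpa using congrArg Prod.snd ((hc 0).symm.trans (hc' 0))
    simp
  · have hk : (K * n * (j - j') : ℤ) ≠ 0 :=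
      mul_ne_zero (mul_ne_zero (by exact_mod_cast hK.ne') hn)
        (sub_ne_zero.mpr (by exact_mod_cast h))
    rw [integral_exp_two_pi_I_int_mul_eq_zero hk, mul_zero]
end

section
/- Fix real numbers ρ, σ, z, integers m, n with n ≠ 0, and a positive integer K, and let T_{ρ,σ}(y,z) = (y+ρ, z+y+σ) and e_{m,n}(y,z) = exp(2πi(my + Knz)). Then for every natural number J, ∫_0^1 | Σ_{j=0}^{J−1} e_{m,n}(T_{ρ,σ}^j(y,z)) |² dy = J; that is, the L²([0,1],dy)-norm of the J-th Birkhoff sum of the character e_{m,n} along the skew-shift, as a function of y, equals exactly √J. -/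
open Complex in
theorem integral_exp_two_pi_int_mul (k : ℤ) :
    ∫ y in (0:ℝ)..1, exp (2 * (Real.pi : ℂ) * I * k * y) = if k = 0 then 1 else 0 := by
  split_ifs with hk
  · simp [hk]
  · have hc : 2 * (Real.pi : ℂ) * I * k ≠ 0 :=
      mul_ne_zero two_pi_I_ne_zero (Int.cast_ne_zero.mpr hk)
    rw [integral_exp_mul_complex hc, div_eq_zero_iff]
    left
    have h := exp_int_mul_two_pi_mul_I k
    rw [mul_comm] at h
    simp [h]

open Complex in
/-- Parseval's identity for trigonometric polynomials with pairwise distinct frequencies. -/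
theorem integral_norm_sq_trigonometric_sum {ι : Type*} (s : Finset ι) (a : ι → ℂ) {k : ι → ℤ}
    (hk : Set.InjOn k s) :
    ∫ y in (0:ℝ)..1, ‖∑ j ∈ s, a j * exp (2 * (Real.pi : ℂ) * I * k j * y)‖ ^ 2 =
      ∑ j ∈ s, ‖a j‖ ^ 2 := by
  classical
  have expand (y : ℝ) :
      ((‖∑ j ∈ s, a j * exp (2 * (Real.pi : ℂ) * I * k j * y)‖ ^ 2 : ℝ) : ℂ) =
        ∑ i ∈ s, ∑ j ∈ s, a i * (starRingEnd ℂ) (a j) *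
          exp (2 * (Real.pi : ℂ) * I * (k i - k j : ℤ) * y) := by
    push_cast
    rw [← mul_conj', map_sum, Finset.sum_mul_sum]
    refine Finset.sum_congr rfl fun i _ => Finset.sum_congr rfl fun j _ => ?_
    rw [map_mul, ← exp_conj, mul_mul_mul_comm, ← exp_add]
    congr 2
    simp only [map_mul, conj_I, conj_ofReal, map_intCast, map_ofNat]
    ring
  apply ofReal_injective
  rw [← intervalIntegral.integral_ofReal]
  simp_rw [expand]
  rw [intervalIntegral.integral_finsetSum fun i _ =>
    Continuous.intervalIntegrable (by fun_prop) _ _]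
  rw [ofReal_sum]
  refine Finset.sum_congr rfl fun i hi => ?_
  rw [intervalIntegral.integral_finsetSum fun j _ =>
    Continuous.intervalIntegrable (by fun_prop) _ _]
  simp_rw [intervalIntegral.integral_const_mul, integral_exp_two_pi_int_mul, sub_eq_zero]
  rw [Finset.sum_eq_single_of_mem i hi fun j hj hji => by
    rw [if_neg fun h => hji (hk hj hi h.symm), mul_zero]]
  simp [mul_conj']

theorem skewShift_iterate {ρ σ : ℝ} {T : ℝ × ℝ → ℝ × ℝ}
    (hT : ∀ y z : ℝ, T (y, z) = (y + ρ, z + y + σ)) (j : ℕ) (y z : ℝ) :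
    T^[j] (y, z) = (y + j * ρ, z + j * y + (j * (j - 1) / 2 * ρ + j * σ)) := by
  induction j with
  | zero => simp
  | succ j ih =>
    rw [Function.iterate_succ_apply', ih, hT]
    ext <;> push_cast <;> ring

/-- Exact square-root growth in the square mean of Birkhoff sums of the character `e_{m,n}`
(`n ≠ 0`) along the linear skew-shift: `∫₀¹ |Σ_{j<J} e_{m,n}(T^j(y,z))|² dy = J`. -/
theorem stmt7 (ρ σ z : ℝ) (m n : ℤ) (hn : n ≠ 0) (K : ℕ) (hK : 0 < K)
    (T : ℝ × ℝ → ℝ × ℝ) (hT : ∀ y' z' : ℝ, T (y', z') = (y' + ρ, z' + y' + σ))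
    (e : ℤ → ℤ → ℝ × ℝ → ℂ)
    (he : ∀ (m' n' : ℤ) (y' z' : ℝ),
      e m' n' (y', z') =
        Complex.exp (2 * (Real.pi : ℂ) * Complex.I *
          ((m' : ℂ) * (y' : ℂ) + (K : ℂ) * (n' : ℂ) * (z' : ℂ)))) :
    ∀ J : ℕ,
      (∫ y in (0:ℝ)..1, ‖∑ j ∈ Finset.range J, e m n (T^[j] (y, z))‖ ^ 2) = (J : ℝ) := by
  intro J
  set b : ℕ → ℝ := fun j =>
    m * (j * ρ) + K * n * (z + (j * (j - 1) / 2 * ρ + j * σ)) with hb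
  have character_eq (y : ℝ) (j : ℕ) : e m n (T^[j] (y, z)) =
      Complex.exp ((2 * Real.pi * b j : ℝ) * Complex.I) *
        Complex.exp (2 * (Real.pi : ℂ) * Complex.I * (m + K * n * j : ℤ) * y) := by
    rw [skewShift_iterate hT, he, ← Complex.exp_add, hb]
    congr 1
    push_cast
    ring
  have frequency_injective : Function.Injective fun j : ℕ => m + K * n * j := by
    intro i j hij
    have hKn : (K : ℤ) * n ≠ 0 := mul_ne_zero (by exact_mod_cast hK.ne') hn
    exact_mod_cast mul_left_cancel₀ hKn (add_left_cancel hij)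
  simp_rw [character_eq]
  rw [integral_norm_sq_trigonometric_sum _ _ frequency_injective.injOn]
  simp only [Complex.norm_exp_ofReal_mul_I]
  simp
end

section
/- Fix real numbers ρ, σ, z, integers m, n with n ≠ 0, and a positive integer K, and let T_{ρ,σ}(y,z) = (y+ρ, z+y+σ) and e_{m,n}(y,z) = exp(2πi(my + Knz)). Then for every natural number J, | ∫_0^1 ( Σ_{j=0}^{J−1} e_{m,n}(T_{ρ,σ}^j(y,z)) ) dy | ≤ 1. -/
/-- The iterates of the linear skew-shift are affine, with slope `j` in the second coordinate. -/
lemma exists_skewShift_iterate_eq {ρ σ : ℝ} {T : ℝ × ℝ → ℝ × ℝ}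
    (hT : ∀ y z : ℝ, T (y, z) = (y + ρ, z + y + σ)) (j : ℕ) :
    ∃ c : ℝ, ∀ y z : ℝ, T^[j] (y, z) = (y + j * ρ, z + j * y + c) := by
  induction j with
  | zero => exact ⟨0, fun y z => by simp⟩
  | succ j ih =>
    obtain ⟨c, hc⟩ := ih
    refine ⟨c + j * ρ + σ, fun y z => ?_⟩
    rw [Function.iterate_succ_apply', hc, hT]
    ext <;> push_cast <;> ring

/-- Orthogonality of characters on `[0,1]`: a nontrivial integer frequency has mean zero. -/
lemma integral_exp_two_pi_I_int_mul (k : ℤ) :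
    ∫ y in (0:ℝ)..1, Complex.exp (2 * (Real.pi : ℂ) * Complex.I * k * (y : ℂ)) =
      if k = 0 then 1 else 0 := by
  split_ifs with hk
  · simp [hk]
  · have hk' : 2 * (Real.pi : ℂ) * Complex.I * k ≠ 0 :=
      mul_ne_zero Complex.two_pi_I_ne_zero (Int.cast_ne_zero.mpr hk)
    rw [integral_exp_mul_complex hk']
    have h : Complex.exp (2 * (Real.pi : ℂ) * Complex.I * k) = 1 :=
      Complex.exp_eq_one_iff.mpr ⟨k, by ring⟩
    simp [h]

/-- The mean over `y ∈ [0,1]` of the `J`-th Birkhoff sum of the character `e_{m,n}` (`n ≠ 0`)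
along the linear skew-shift has modulus at most `1`. -/
theorem stmt8 (ρ σ z : ℝ) (m n : ℤ) (hn : n ≠ 0) (K : ℕ) (hK : 0 < K)
    (T : ℝ × ℝ → ℝ × ℝ) (hT : ∀ y' z' : ℝ, T (y', z') = (y' + ρ, z' + y' + σ))
    (e : ℤ → ℤ → ℝ × ℝ → ℂ)
    (he : ∀ (m' n' : ℤ) (y' z' : ℝ),
      e m' n' (y', z') =
        Complex.exp (2 * (Real.pi : ℂ) * Complex.I *
          ((m' : ℂ) * (y' : ℂ) + (K : ℂ) * (n' : ℂ) * (z' : ℂ)))) :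
    ∀ J : ℕ,
      ‖∫ y in (0:ℝ)..1, ∑ j ∈ Finset.range J, e m n (T^[j] (y, z))‖ ≤ 1 := by
  intro J
  choose c hc using exists_skewShift_iterate_eq hT
  let k : ℕ → ℤ := fun j => m + K * n * j
  let θ : ℕ → ℝ := fun j => 2 * Real.pi * (m * (j * ρ) + K * n * (z + c j))
  have hterm : ∀ (j : ℕ) (y : ℝ), e m n (T^[j] (y, z)) =
      Complex.exp (θ j * Complex.I) *
        Complex.exp (2 * (Real.pi : ℂ) * Complex.I * k j * (y : ℂ)) := by
    intro j y
    rw [hc, he, ← Complex.exp_add]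
    congr 1
    simp only [k, θ]
    push_cast
    ring
  have hk : ∀ i j : ℕ, k i = 0 → k j = 0 → i = j := by
    intro i j hi hj
    have hKn : (K : ℤ) * n ≠ 0 := mul_ne_zero (by exact_mod_cast hK.ne') hn
    have h : (K : ℤ) * n * i = K * n * j := by
      simp only [k] at hi hj
      linarith
    exact_mod_cast mul_left_cancel₀ hKn h
  simp only [hterm]
  rw [intervalIntegral.integral_finsetSum
    fun j _ => (by fun_prop : Continuous _).intervalIntegrable _ _]
  simp only [intervalIntegral.integral_const_mul, integral_exp_two_pi_I_int_mul]
  calc _ ≤ ∑ j ∈ Finset.range J, if k j = 0 then (1 : ℝ) else 0 := by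
        refine norm_sum_le_of_le _ fun j _ => ?_
        rw [norm_mul, Complex.norm_exp_ofReal_mul_I]
        split_ifs <;> simp
    _ = ((Finset.range J).filter fun j => k j = 0).card := by simp
    _ ≤ 1 := by
        exact_mod_cast Finset.card_le_one.mpr fun i hi j hj =>
          hk i j (Finset.mem_filter.mp hi).2 (Finset.mem_filter.mp hj).2
end

section
/- Let R, r, t be real numbers with R > r > 3t > 3. There exists a constant C_{r,t} > 0 such that the following holds for every nonconstant holomorphic function f on the open ball B_ℂ(0,R) ⊆ ℂ. Let M_f(r) = sup_{|z| ≤ r} |f(z)| and let O_f(t) = sup_{z, z' ∈ B_ℂ(0,t)} |f(z) − f(z')| be the oscillation of f on B_ℂ(0,t) (which is strictly positive since f is nonconstant). Then for every w ∈ ℂ, the number of solutions of f(z) = w in B_ℂ(0,t), counted with multiplicity (each solution z₀ counted with the order of vanishing of f − w at z₀), is at most C_{r,t} · log( 4 M_f(r) / O_f(t) ). -/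
open Metric

theorem exists_eq_pow_mul_of_le_analyticOrderAt {U : Set ℂ} (hU : IsOpen U) {g : ℂ → ℂ}
    (hg : DifferentiableOn ℂ g U) {z₀ : ℂ} (hz₀ : z₀ ∈ U) {n : ℕ}
    (hn : n ≤ analyticOrderAt g z₀) :
    ∃ h : ℂ → ℂ, DifferentiableOn ℂ h U ∧ ∀ z ∈ U, g z = (z - z₀) ^ n * h z := by
  classical
  obtain ⟨φ, hφ, hgφ⟩ := (natCast_le_analyticOrderAt (hg.analyticAt (hU.mem_nhds hz₀))).1 hn
  simp only [smul_eq_mul] at hgφ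
  set h : ℂ → ℂ := Function.update (fun z => g z / (z - z₀) ^ n) z₀ (φ z₀) with h_def
  have h_ne : ∀ z, z ≠ z₀ → h z = g z / (z - z₀) ^ n := fun z hz => by
    simp [h_def, Function.update_of_ne hz]
  have h_near : h =ᶠ[nhds z₀] φ := by
    filter_upwards [hgφ] with z hz
    rcases eq_or_ne z z₀ with rfl | hne
    · simp [h_def]
    · rw [h_ne z hne, hz, mul_div_cancel_left₀ _ (pow_ne_zero _ (sub_ne_zero.2 hne))]
  refine ⟨h, fun z hz => ?_, fun z hz => ?_⟩
  · rcases eq_or_ne z z₀ with rfl | hne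
    · exact (hφ.differentiableAt.congr_of_eventuallyEq h_near).differentiableWithinAt
    · have hd : DifferentiableAt ℂ (fun z => g z / (z - z₀) ^ n) z :=
        (hg.differentiableAt (hU.mem_nhds hz)).fun_div (by fun_prop)
          (pow_ne_zero _ (sub_ne_zero.2 hne))
      refine (hd.congr_of_eventuallyEq ?_).differentiableWithinAt
      filter_upwards [isOpen_ne.mem_nhds hne] with y hy using h_ne y hy
  · rcases eq_or_ne z z₀ with rfl | hne
    · rw [h_near.eq_of_nhds, hgφ.self_of_nhds]
    · rw [h_ne z hne, mul_div_cancel₀ _ (pow_ne_zero _ (sub_ne_zero.2 hne))]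

theorem exists_eq_prod_pow_mul_of_le_analyticOrderAt {U : Set ℂ} (hU : IsOpen U) {g : ℂ → ℂ}
    (hg : DifferentiableOn ℂ g U) {S : Finset ℂ} {m : ℂ → ℕ} (hSU : ∀ z ∈ S, z ∈ U)
    (hm : ∀ z ∈ S, m z ≤ analyticOrderAt g z) :
    ∃ h : ℂ → ℂ, DifferentiableOn ℂ h U ∧
      ∀ u ∈ U, g u = (∏ z ∈ S, (u - z) ^ m z) * h u := by
  classical
  induction S using Finset.induction_on with
  | empty => exact ⟨g, hg, by simp⟩
  | insert z₀ S hz₀ ih =>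
    obtain ⟨h, hd, hgh⟩ := ih (fun z hz => hSU z (Finset.mem_insert_of_mem hz))
      (fun z hz => hm z (Finset.mem_insert_of_mem hz))
    have hz₀U : z₀ ∈ U := hSU z₀ (Finset.mem_insert_self _ _)
    have hP : AnalyticAt ℂ (fun u => ∏ z ∈ S, (u - z) ^ m z) z₀ := by fun_prop
    have hP0 : analyticOrderAt (fun u => ∏ z ∈ S, (u - z) ^ m z) z₀ = 0 := by
      rw [hP.analyticOrderAt_eq_zero]
      refine Finset.prod_ne_zero_iff.2 fun z hz => pow_ne_zero _ (sub_ne_zero.2 ?_)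
      rintro rfl
      exact hz₀ hz
    have h_order : analyticOrderAt g z₀ = analyticOrderAt h z₀ := by
      have : g =ᶠ[nhds z₀] (fun u => ∏ z ∈ S, (u - z) ^ m z) * h := by
        filter_upwards [hU.mem_nhds hz₀U] with u hu using hgh u hu
      rw [analyticOrderAt_congr this,
        analyticOrderAt_mul hP (hd.analyticAt (hU.mem_nhds hz₀U)), hP0, zero_add]
    obtain ⟨k, hk, hhk⟩ := exists_eq_pow_mul_of_le_analyticOrderAt hU hd hz₀U
      (h_order ▸ hm z₀ (Finset.mem_insert_self _ _))
    refine ⟨k, hk, fun u hu => ?_⟩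
    rw [Finset.prod_insert hz₀, hgh u hu, hhk u hu]
    ring

/-- Blaschke-type estimate: zeros of `g` of total multiplicity `n` within distance `s` of the
centre force `‖g a‖ ≤ (s / ρ) ^ n * K`, where `K` bounds `‖g‖` on the circle of radius `ρ`. -/
theorem norm_center_mul_pow_le_of_le_analyticOrderAt {U : Set ℂ} (hU : IsOpen U) {g : ℂ → ℂ}
    (hg : DifferentiableOn ℂ g U) {S : Finset ℂ} {m : ℂ → ℕ} (hSU : ∀ z ∈ S, z ∈ U)
    (hm : ∀ z ∈ S, m z ≤ analyticOrderAt g z) {a : ℂ} {ρ s K : ℝ} (hρ : 0 < ρ)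
    (haU : closedBall a ρ ⊆ U) (hs : ∀ z ∈ S, ‖a - z‖ ≤ s)
    (hK : ∀ u ∈ sphere a ρ, ‖g u‖ ≤ K) :
    ‖g a‖ * ρ ^ (∑ z ∈ S, m z) ≤ s ^ (∑ z ∈ S, m z) * K := by
  obtain ⟨h, hd, hgh⟩ := exists_eq_prod_pow_mul_of_le_analyticOrderAt hU hg hSU hm
  set n := ∑ z ∈ S, m z with hn
  set H : ℂ → ℂ := fun u =>
    (∏ z ∈ S, ((ρ : ℂ) ^ 2 - (starRingEnd ℂ) (z - a) * (u - a)) ^ m z) * h u with hH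
  have hH_sphere : ∀ u ∈ sphere a ρ, ‖H u‖ = ρ ^ n * ‖g u‖ := by
    intro u hu
    have hua : ‖u - a‖ = ρ := by simpa [dist_eq_norm] using hu
    have key : ∀ z, ‖(ρ : ℂ) ^ 2 - (starRingEnd ℂ) (z - a) * (u - a)‖ = ρ * ‖u - z‖ := by
      intro z
      have : (ρ : ℂ) ^ 2 - (starRingEnd ℂ) (z - a) * (u - a)
          = (starRingEnd ℂ) (u - z) * (u - a) := by
        rw [← hua, ← Complex.conj_mul']
        simp only [map_sub]
        ring
      rw [this, norm_mul, RCLike.norm_conj, hua, mul_comm]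
    rw [hgh u (haU (sphere_subset_closedBall hu)), hH]
    simp only [norm_mul, norm_prod, norm_pow, key, mul_pow, Finset.prod_mul_distrib,
      Finset.prod_pow_eq_pow_sum, ← hn]
    ring
  have hH_center : ‖H a‖ ≤ ρ ^ n * K := by
    have hdc : DiffContOnCl ℂ H (ball a ρ) := by
      refine DifferentiableOn.diffContOnCl ?_
      rw [closure_ball a hρ.ne']
      exact DifferentiableOn.mul (by fun_prop) (hd.mono haU)
    refine Complex.norm_le_of_forall_mem_frontier_norm_le isBounded_ball hdc ?_
      (subset_closure (mem_ball_self hρ))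
    rw [frontier_ball a hρ.ne']
    intro u hu
    rw [hH_sphere u hu]
    exact mul_le_mul_of_nonneg_left (hK u hu) (by positivity)
  have hHa : ‖H a‖ = ρ ^ n * (ρ ^ n * ‖h a‖) := by
    simp only [hH, sub_self, mul_zero, sub_zero, norm_mul, norm_pow,
      Complex.norm_real, Real.norm_of_nonneg hρ.le, Finset.prod_pow_eq_pow_sum, ← hn]
    ring
  have hga : ‖g a‖ ≤ s ^ n * ‖h a‖ := by
    rw [hgh a (haU (mem_closedBall_self hρ.le)), norm_mul, hn, ← Finset.prod_pow_eq_pow_sum,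
      norm_prod]
    gcongr with z hz
    rw [norm_pow]
    exact pow_le_pow_left₀ (norm_nonneg _) (hs z hz) _
  have hsn : 0 ≤ s ^ n := by
    rw [hn, ← Finset.prod_pow_eq_pow_sum]
    exact Finset.prod_nonneg fun z hz => pow_nonneg ((norm_nonneg _).trans (hs z hz)) _
  have hha : ρ ^ n * ‖h a‖ ≤ K := by
    rw [hHa] at hH_center
    exact le_of_mul_le_mul_left hH_center (by positivity)
  calc ‖g a‖ * ρ ^ n ≤ s ^ n * ‖h a‖ * ρ ^ n := by gcongr
    _ = s ^ n * (ρ ^ n * ‖h a‖) := by ring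
    _ ≤ s ^ n * K := by gcongr

/-- Lemma 9.4: quantitative valency bound for a nonconstant holomorphic function on
`B_ℂ(0,R)` in terms of its maximum modulus `M_f(r)` on `closedBall 0 r` and its oscillation
`O_f(t)` on `ball 0 t`.  The number of solutions of `f(z) = w` in `ball 0 t`, counted with
multiplicity (encoded by a finite set `S` of distinct solutions together with lower bounds
`mul z` on the order of vanishing of `f - w`, witnessed by vanishing of the derivatives of
`f` of all orders `1 ≤ j < mul z`), is at most `C_{r,t} · log(4 M_f(r) / O_f(t))`. -/
theorem stmt9 (R r t : ℝ) (hRr : r < R) (hrt : 3 * t < r) (ht : 3 < 3 * t) :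
    ∃ C : ℝ, 0 < C ∧
      ∀ f : ℂ → ℂ, DifferentiableOn ℂ f (ball (0 : ℂ) R) →
        (∃ z ∈ ball (0 : ℂ) R, ∃ z' ∈ ball (0 : ℂ) R, f z ≠ f z') →
        ∀ w : ℂ, ∀ S : Finset ℂ, ∀ mul : ℂ → ℕ,
          (∀ z ∈ S, z ∈ ball (0 : ℂ) t) →
          (∀ z ∈ S, f z = w) →
          (∀ z ∈ S, ∀ j : ℕ, 1 ≤ j → j < mul z → iteratedDeriv j f z = 0) →
          (∑ z ∈ S, (mul z : ℝ)) ≤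
            C * Real.log
              (4 * sSup ((fun z => ‖f z‖) '' closedBall (0 : ℂ) r) /
                sSup ((fun p : ℂ × ℂ => ‖f p.1 - f p.2‖) ''
                  (ball (0 : ℂ) t ×ˢ ball (0 : ℂ) t))) := by
  have hq : 1 < (r - t) / (2 * t) := by
    rw [one_lt_div (by linarith)]
    linarith
  have hL : 0 < Real.log ((r - t) / (2 * t)) := Real.log_pos hq
  refine ⟨2 / Real.log ((r - t) / (2 * t)), by positivity, ?_⟩
  intro f hf ⟨x, hx, x', hx', hxx'⟩ w S mul hSt hSw hSmul
  set M := sSup ((fun z => ‖f z‖) '' closedBall (0 : ℂ) r)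
  set V := (fun p : ℂ × ℂ => ‖f p.1 - f p.2‖) '' (ball (0 : ℂ) t ×ˢ ball (0 : ℂ) t)
  have hfM : ∀ z ∈ closedBall (0 : ℂ) r, ‖f z‖ ≤ M := fun z hz =>
    le_csSup ((isCompact_closedBall (0 : ℂ) r).bddAbove_image
      (hf.continuousOn.mono (closedBall_subset_ball hRr)).norm) ⟨z, hz, rfl⟩
  have htr : ball (0 : ℂ) t ⊆ closedBall 0 r :=
    (ball_subset_ball (by linarith)).trans ball_subset_closedBall
  have htR : ball (0 : ℂ) t ⊆ ball 0 R := ball_subset_ball (by linarith)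
  have hV_le : ∀ v ∈ V, v ≤ 2 * M := by
    rintro _ ⟨⟨p, p'⟩, ⟨hp, hp'⟩, rfl⟩
    have h₁ := hfM p (htr hp)
    have h₂ := hfM p' (htr hp')
    have h₃ := norm_sub_le (f p) (f p')
    show ‖f p - f p'‖ ≤ 2 * M
    linarith
  have h0t : (0 : ℂ) ∈ ball (0 : ℂ) t := mem_ball_self (by linarith)
  have hV_ne : V.Nonempty := ⟨_, (0, 0), ⟨h0t, h0t⟩, rfl⟩
  have hV_bdd : BddAbove V := ⟨2 * M, hV_le⟩
  have hO_le : sSup V ≤ 2 * M := csSup_le hV_ne hV_le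
  have hO_pos : 0 < sSup V := by
    by_contra! hO
    have h_const : Set.EqOn f (fun _ => f 0) (ball 0 R) := by
      refine (hf.analyticOnNhd isOpen_ball).eqOn_of_preconnected_of_eventuallyEq
        analyticOnNhd_const (convex_ball (0 : ℂ) R).isPreconnected (htR h0t) ?_
      filter_upwards [isOpen_ball.mem_nhds h0t] with z hz
      have : ‖f z - f 0‖ ≤ 0 := (le_csSup hV_bdd ⟨(z, 0), ⟨hz, h0t⟩, rfl⟩).trans hO
      exact sub_eq_zero.1 (norm_le_zero_iff.1 this)
    exact hxx' ((h_const hx).trans (h_const hx').symm)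
  have hratio : 2 ≤ 4 * M / sSup V := by
    rw [le_div_iff₀ hO_pos]
    linarith
  rcases S.eq_empty_or_nonempty with rfl | ⟨z₀, hz₀⟩
  · have : 0 ≤ Real.log (4 * M / sSup V) := Real.log_nonneg (by linarith)
    simp only [Finset.sum_empty]
    positivity
  have hwM : ‖w‖ ≤ M := hSw z₀ hz₀ ▸ hfM z₀ (htr (hSt z₀ hz₀))
  obtain ⟨a, ha, haw⟩ : ∃ a ∈ ball (0 : ℂ) t, sSup V / 4 ≤ ‖f a - w‖ := by
    by_contra! h_small
    have : sSup V ≤ sSup V / 2 := by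
      refine csSup_le hV_ne ?_
      rintro _ ⟨⟨p, p'⟩, ⟨hp, hp'⟩, rfl⟩
      have h₁ := h_small p hp
      have h₂ := h_small p' hp'
      have h₃ := norm_sub_le (f p - w) (f p' - w)
      rw [sub_sub_sub_cancel_right] at h₃
      show ‖f p - f p'‖ ≤ sSup V / 2
      linarith
    linarith
  have ha' : ‖a‖ < t := by simpa using ha
  have ha_sub : closedBall a (r - t) ⊆ closedBall 0 r :=
    closedBall_subset_closedBall' (by rw [dist_zero_right]; linarith)
  have h_order : ∀ z ∈ S, mul z ≤ analyticOrderAt (fun u => f u - w) z := by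
    intro z hz
    have hfz : AnalyticAt ℂ f z := hf.analyticAt (isOpen_ball.mem_nhds (htR (hSt z hz)))
    rw [natCast_le_analyticOrderAt_iff_iteratedDeriv_eq_zero (hfz.fun_sub analyticAt_const)]
    intro j hj
    rcases Nat.eq_zero_or_pos j with rfl | hj0
    · simp [hSw z hz]
    · have : (fun u => f u - w) = fun u => -w + f u := by
        ext u
        ring
      rw [this, iteratedDeriv_const_add hj0]
      exact hSmul z hz j hj0 hj
  have h_main := norm_center_mul_pow_le_of_le_analyticOrderAt (K := 2 * M) (s := 2 * t)
    (a := a) (ρ := r - t) isOpen_ball (hf.sub_const w) (fun z hz => htR (hSt z hz)) h_order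
    (by linarith) (ha_sub.trans (closedBall_subset_ball hRr))
    (fun z hz => by
      have h₁ : ‖z‖ < t := by simpa using hSt z hz
      have h₂ := norm_sub_le a z
      linarith)
    (fun u hu => by
      have h₁ := hfM u (ha_sub (sphere_subset_closedBall hu))
      have h₂ := norm_sub_le (f u) w
      linarith)
  rw [← Nat.cast_sum]
  set n := ∑ z ∈ S, mul z
  have h_pow : ((r - t) / (2 * t)) ^ n ≤ (4 * M / sSup V) ^ 2 := by
    have h2t : 0 < (2 * t) ^ n := pow_pos (by linarith) n
    have hrt' : 0 < (r - t) ^ n := pow_pos (by linarith) n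
    have h₁ : sSup V / 4 * (r - t) ^ n ≤ (2 * t) ^ n * (2 * M) :=
      (mul_le_mul_of_nonneg_right haw hrt'.le).trans h_main
    calc ((r - t) / (2 * t)) ^ n ≤ 2 * (4 * M / sSup V) := by
          rw [div_pow, div_le_iff₀ h2t, ← mul_div_assoc, div_mul_eq_mul_div, le_div_iff₀ hO_pos]
          linarith
      _ ≤ (4 * M / sSup V) ^ 2 := by nlinarith
  have h_log := Real.log_le_log (pow_pos (by linarith) n) h_pow
  rw [Real.log_pow, Real.log_pow] at h_log
  rw [div_mul_eq_mul_div, le_div_iff₀ hL]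
  exact_mod_cast h_log
end

section
/- Let n ≥ 1 and let R > r > 1 be real numbers. Let F be a family of holomorphic functions on the open ball B_ℂ(0,R) ⊆ ℂⁿ such that: (i) F is a normal family, i.e. every sequence in F has a subsequence converging uniformly on compact subsets of B_ℂ(0,R); and (ii) no function f in the closure of F (with respect to locally uniform convergence) is constant on L ∩ B_ℂ(0,R) for any complex affine line L ⊆ ℂⁿ meeting B_ℂ(0,R). Then sup_{f ∈ F} v_f(r) < +∞, where v_f(r) denotes the supremum, over all complex affine lines L meeting B_ℂ(0,r) and all values w ∈ ℂ, of the number of solutions of f = w on L ∩ B_ℂ(0,r), counted with multiplicity. -/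
open Metric Filter

/-- A holomorphic function with `∑ ζ ∈ S, mul ζ` zeros in `ball c ρ` is small at `c` compared to its
maximum on `sphere c (3 * ρ)`. -/
theorem norm_mul_two_pow_sum_le_of_le_analyticOrderAt {U : Set ℂ} (hU : IsOpen U) {c : ℂ} {ρ : ℝ}
    (hρ : 0 < ρ) (hsub : closedBall c (3 * ρ) ⊆ U) (S : Finset ℂ) (hS : ∀ ζ ∈ S, ζ ∈ ball c ρ)
    (N : ℕ) : ∀ (φ : ℂ → ℂ) (M : ℝ) (mul : ℂ → ℕ), DifferentiableOn ℂ φ U →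
      (∀ z ∈ sphere c (3 * ρ), ‖φ z‖ ≤ M) → (∀ ζ ∈ S, (mul ζ : ℕ∞) ≤ analyticOrderAt φ ζ) →
      ∑ ζ ∈ S, mul ζ = N → ‖φ c‖ * 2 ^ N ≤ M := by
  have h3 : 0 < 3 * ρ := by positivity
  induction N with
  | zero =>
    intro φ M mul hφ hM _ _
    have hdc : DiffContOnCl ℂ φ (ball c (3 * ρ)) :=
      (hφ.mono (by rw [closure_ball c h3.ne']; exact hsub)).diffContOnCl
    simpa using Complex.norm_le_of_forall_mem_frontier_norm_le isBounded_ball hdc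
      (by rwa [frontier_ball c h3.ne']) (subset_closure (mem_ball_self h3))
  | succ N ih =>
    intro φ M mul hφ hM hord hsum
    obtain ⟨ζ, hζS, hζ⟩ : ∃ ζ ∈ S, mul ζ ≠ 0 := by
      by_contra! h
      rw [Finset.sum_eq_zero h] at hsum
      omega
    have hζb := hS ζ hζS
    have hballU : ball c ρ ⊆ U :=
      (ball_subset_closedBall.trans (closedBall_subset_closedBall (by linarith))).trans hsub
    have hψ : DifferentiableOn ℂ (dslope φ ζ) U :=
      (Complex.differentiableOn_dslope (hU.mem_nhds (hballU hζb))).2 hφ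
    have hφζ : φ ζ = 0 := by
      apply apply_eq_zero_of_analyticOrderAt_ne_zero
      intro h0
      have := hord ζ hζS
      rw [h0] at this
      exact hζ (by simpa using this)
    have hfac : ∀ z, φ z = (z - ζ) * dslope φ ζ z := fun z => by
      simpa [hφζ] using (sub_smul_dslope φ ζ z).symm
    have hordmul : ∀ x ∈ S, analyticOrderAt φ x =
        analyticOrderAt (fun z => z - ζ) x + analyticOrderAt (dslope φ ζ) x := fun x hx => by
      rw [← analyticOrderAt_mul (by fun_prop)
        (hψ.analyticAt (hU.mem_nhds (hballU (hS x hx))))]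
      exact congrArg (analyticOrderAt · x) (funext hfac)
    have hb : ∀ z ∈ sphere c (3 * ρ), ‖dslope φ ζ z‖ ≤ M / (2 * ρ) := by
      intro z hz
      have h1 : 2 * ρ ≤ ‖z - ζ‖ := by
        rw [mem_sphere, dist_eq_norm] at hz
        rw [mem_ball, dist_eq_norm] at hζb
        have := norm_sub_norm_le (z - c) (ζ - c)
        rw [sub_sub_sub_cancel_right] at this
        linarith
      rw [le_div_iff₀ (by positivity)]
      calc ‖dslope φ ζ z‖ * (2 * ρ) ≤ ‖dslope φ ζ z‖ * ‖z - ζ‖ := by gcongr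
        _ = ‖φ z‖ := by rw [hfac z, norm_mul, mul_comm]
        _ ≤ M := hM z hz
    have key := ih (dslope φ ζ) (M / (2 * ρ)) (Function.update mul ζ (mul ζ - 1)) hψ hb ?_ ?_
    · have hc : ‖φ c‖ ≤ ρ * ‖dslope φ ζ c‖ := by
        rw [hfac c, norm_mul]
        gcongr
        rw [mem_ball'] at hζb
        rw [← dist_eq_norm]
        exact hζb.le
      rw [le_div_iff₀ (by positivity)] at key
      calc ‖φ c‖ * 2 ^ (N + 1) ≤ (ρ * ‖dslope φ ζ c‖) * 2 ^ (N + 1) := by gcongr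
        _ = ‖dslope φ ζ c‖ * 2 ^ N * (2 * ρ) := by ring
        _ ≤ M := key
    · intro x hx
      have h1 := hord x hx
      rw [hordmul x hx] at h1
      rcases eq_or_ne x ζ with rfl | hne
      · rw [analyticOrderAt_id_sub_const_self] at h1
        rw [Function.update_self]
        obtain ⟨m, hm⟩ := Nat.exists_eq_succ_of_ne_zero hζ
        rw [hm] at h1 ⊢
        rw [Nat.succ_eq_add_one, Nat.cast_add, Nat.cast_one, add_comm] at h1
        simpa using (ENat.add_le_add_iff_left (by simp)).1 h1
      · rw [analyticOrderAt_id_sub_const_of_ne hne, zero_add] at h1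
        rwa [Function.update_of_ne hne]
    · have h1 := Finset.sum_update_of_mem hζS mul (mul ζ - 1)
      have h2 := Finset.add_sum_erase S mul hζS
      rw [Finset.sdiff_singleton_eq_erase] at h1
      omega

open Topology in
/-- Locally uniform limits are compatible with convergence of affine parametrizations. -/
theorem TendstoLocallyUniformlyOn.tendsto_line {E : Type*} [NormedAddCommGroup E] [NormedSpace ℂ E]
    {Ω : Set E} (hΩ : IsOpen Ω) {f : ℕ → E → ℂ} {g : E → ℂ}
    (hfg : TendstoLocallyUniformlyOn f g atTop Ω) (hg : ContinuousOn g Ω) {a : ℕ → E} {b : ℕ → E}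
    {a₀ b₀ : E} (ha : Tendsto a atTop (𝓝 a₀)) (hb : Tendsto b atTop (𝓝 b₀)) {ξ₀ : ℂ}
    (hξ : a₀ + ξ₀ • b₀ ∈ Ω) :
    Tendsto (fun p : ℕ × ℂ => f p.1 (a p.1 + p.2 • b p.1)) (atTop ×ˢ 𝓝 ξ₀)
      (𝓝 (g (a₀ + ξ₀ • b₀))) := by
  refine tendsto_comp_of_locally_uniform_limit (F := fun p : ℕ × ℂ => f p.1)
    (g := fun p : ℕ × ℂ => a p.1 + p.2 • b p.1)
    (hg.continuousAt (hΩ.mem_nhds hξ)) ?_ fun u hu => ?_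
  · exact (ha.comp tendsto_fst).add (tendsto_snd.smul (hb.comp tendsto_fst))
  · obtain ⟨t, ht, h⟩ := hfg u hu _ hξ
    rw [hΩ.nhdsWithin_eq hξ] at ht
    exact ⟨t, ht, tendsto_fst.eventually h⟩

open Topology in
/-- Near a point of a limit line on which the limit function is not constant, the number of
solutions along converging lines is eventually bounded. -/
theorem exists_nhds_eventually_sum_le {E : Type*} [NormedAddCommGroup E] [NormedSpace ℂ E]
    {Ω : Set E} (hΩ : IsOpen Ω) {f : ℕ → E → ℂ} {g : E → ℂ}
    (hf : ∀ k, DifferentiableOn ℂ (f k) Ω)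
    (hfg : TendstoLocallyUniformlyOn f g atTop Ω) {a b : ℕ → E}
    {a₀ b₀ : E} (ha : Tendsto a atTop (𝓝 a₀)) (hb : Tendsto b atTop (𝓝 b₀)) {w : ℕ → ℂ} {w₀ : ℂ}
    (hw : Tendsto w atTop (𝓝 w₀)) {ξ₀ : ℂ} (hξ : a₀ + ξ₀ • b₀ ∈ Ω)
    (hne : ∃ᶠ ξ in 𝓝 ξ₀, g (a₀ + ξ • b₀) ≠ w₀) :
    ∃ V ∈ 𝓝 ξ₀, ∃ N : ℕ, ∀ᶠ k in atTop, ∀ (S : Finset ℂ) (mul : ℂ → ℕ), (∀ ζ ∈ S, ζ ∈ V) →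
      (∀ ζ ∈ S, (mul ζ : ℕ∞) ≤ analyticOrderAt (fun ξ => f k (a k + ξ • b k) - w k) ζ) →
      ∑ ζ ∈ S, mul ζ ≤ N := by
  have hg : ContinuousOn g Ω :=
    hfg.continuousOn (Frequently.of_forall fun k => (hf k).continuousOn)
  have hlim := fun {ξ : ℂ} (h : a₀ + ξ • b₀ ∈ Ω) =>
    (hfg.tendsto_line hΩ hg ha hb h).sub (hw.comp tendsto_fst)
  have hpt : Tendsto (fun p : ℕ × ℂ => a p.1 + p.2 • b p.1) (atTop ×ˢ 𝓝 ξ₀)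
      (𝓝 (a₀ + ξ₀ • b₀)) :=
    (ha.comp tendsto_fst).add (tendsto_snd.smul (hb.comp tendsto_fst))
  set M : ℝ := ‖g (a₀ + ξ₀ • b₀) - w₀‖ + 1
  have hbd : ∀ᶠ p : ℕ × ℂ in atTop ×ˢ 𝓝 ξ₀,
      ‖f p.1 (a p.1 + p.2 • b p.1) - w p.1‖ ≤ M ∧ a p.1 + p.2 • b p.1 ∈ Ω :=
    (((hlim hξ).norm.eventually_lt_const (lt_add_one _)).mono fun _ h => h.le).and
      (hpt.eventually (hΩ.mem_nhds hξ))
  obtain ⟨pa, hpa, pb, hpb, hab⟩ := eventually_prod_iff.1 hbd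
  have hline : ∀ᶠ ξ in 𝓝 ξ₀, a₀ + ξ • b₀ ∈ Ω :=
    (Continuous.tendsto (by fun_prop : Continuous fun ξ : ℂ => a₀ + ξ • b₀) ξ₀).eventually
      (hΩ.mem_nhds hξ)
  obtain ⟨ε, hε, hball⟩ := Metric.eventually_nhds_iff_ball.1 hpb
  set ρ := ε / 5 with hρ
  have hρ0 : 0 < ρ := by positivity
  have hnear : ∀ᶠ ξ in 𝓝 ξ₀, ξ ∈ ball ξ₀ ρ := ball_mem_nhds ξ₀ hρ0
  obtain ⟨c, hcne, hcb, hcΩ⟩ := (hne.and_eventually (hnear.and hline)).exists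
  have hc : 0 < ‖g (a₀ + c • b₀) - w₀‖ := norm_pos_iff.2 (sub_ne_zero.2 hcne)
  set δ := ‖g (a₀ + c • b₀) - w₀‖ / 2 with hδ
  have hδ0 : 0 < δ := by positivity
  have hck : ∀ᶠ k in atTop, δ < ‖f k (a k + c • b k) - w k‖ :=
    ((hlim hcΩ).comp (tendsto_id.prodMk tendsto_const_nhds)).norm.eventually_const_lt
      (half_lt_self hc)
  obtain ⟨N, hN⟩ := pow_unbounded_of_one_lt (M / δ) (one_lt_two : (1 : ℝ) < 2)
  refine ⟨ball c ρ, isOpen_ball.mem_nhds (mem_ball'.2 hcb), N, ?_⟩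
  filter_upwards [hpa, hck] with k hk hkc S mul hS hmul
  have hsub : closedBall c (3 * ρ) ⊆ ball ξ₀ ε := by
    refine closedBall_subset_ball' ?_
    have := mem_ball.1 hcb
    linarith
  have hopen : IsOpen {ξ : ℂ | a k + ξ • b k ∈ Ω} :=
    hΩ.preimage (by fun_prop : Continuous fun ξ : ℂ => a k + ξ • b k)
  have hdiff : DifferentiableOn ℂ (fun ξ : ℂ => f k (a k + ξ • b k)) {ξ | a k + ξ • b k ∈ Ω} :=
    (hf k).comp (by fun_prop) fun ξ h => h
  have hsmall := norm_mul_two_pow_sum_le_of_le_analyticOrderAt hopen hρ0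
    (fun ξ h => (hab hk (hball ξ (hsub h))).2) S hS _ (fun ξ => f k (a k + ξ • b k) - w k) M mul
    (hdiff.sub_const _)
    (fun ξ h => (hab hk (hball ξ (hsub (sphere_subset_closedBall h)))).1) hmul rfl
  by_contra! hlt
  rw [div_lt_iff₀ hδ0] at hN
  have : δ * 2 ^ N ≤ ‖f k (a k + c • b k) - w k‖ * 2 ^ ∑ ζ ∈ S, mul ζ := by
    gcongr
    norm_num
  linarith

open Topology in
/-- If the limit function is not constant on the limit line, then the number of solutions in a
smaller ball along converging lines is eventually bounded. -/
theorem exists_eventually_sum_le {E : Type*} [NormedAddCommGroup E] [NormedSpace ℂ E]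
    {R r : ℝ} (hrR : r < R) {f : ℕ → E → ℂ} {g : E → ℂ}
    (hf : ∀ k, DifferentiableOn ℂ (f k) (ball 0 R))
    (hfg : TendstoLocallyUniformlyOn f g atTop (ball 0 R)) {a b : ℕ → E}
    {a₀ b₀ : E} (ha : Tendsto a atTop (𝓝 a₀)) (hb : Tendsto b atTop (𝓝 b₀))
    (har : ∀ k, a k ∈ ball 0 r) (hb1 : ∀ k, ‖b k‖ = 1)
    (hne : ¬ ∀ ζ ζ' : ℂ, a₀ + ζ • b₀ ∈ ball 0 R → a₀ + ζ' • b₀ ∈ ball 0 R →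
      g (a₀ + ζ • b₀) = g (a₀ + ζ' • b₀)) :
    ∃ N : ℕ, ∀ᶠ k in atTop, ∀ (S : Finset ℂ) (mul : ℂ → ℕ),
      (∀ ζ ∈ S, a k + ζ • b k ∈ ball 0 r) →
      (∀ ζ ∈ S, (mul ζ : ℕ∞) ≤ analyticOrderAt (fun ξ => f k (a k + ξ • b k) - f k (a k)) ζ) →
      ∑ ζ ∈ S, mul ζ ≤ N := by
  have hg : ContinuousOn g (ball 0 R) :=
    hfg.continuousOn (Frequently.of_forall fun k => (hf k).continuousOn)
  have hr0 : 0 < r := pos_of_mem_ball (har 0)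
  have ha₀r : ‖a₀‖ ≤ r :=
    le_of_tendsto' ha.norm fun k => (mem_ball_zero_iff.1 (har k)).le
  have ha₀ : a₀ ∈ ball 0 R := mem_ball_zero_iff.2 (ha₀r.trans_lt hrR)
  have hb₀ : ‖b₀‖ = 1 := tendsto_nhds_unique hb.norm (by simp [hb1])
  have hw : Tendsto (fun k => f k (a k)) atTop (𝓝 (g a₀)) :=
    hfg.tendsto_comp (hg a₀ ha₀) ha₀ (by rwa [isOpen_ball.nhdsWithin_eq ha₀])
  have hcont : Continuous fun ξ : ℂ => a₀ + ξ • b₀ := by fun_prop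
  set D : Set ℂ := {ξ | a₀ + ξ • b₀ ∈ ball (0 : E) R} with hD
  have hDo : IsOpen D := isOpen_ball.preimage hcont
  have hDc : IsPreconnected D := by
    apply Convex.isPreconnected
    intro x hx y hy s t hs ht hst
    have := (convex_ball (0 : E) R) hx hy hs ht hst
    have he : a₀ + (s • x + t • y) • b₀ = s • (a₀ + x • b₀) + t • (a₀ + y • b₀) := by
      rw [smul_add, smul_add, add_smul, smul_assoc, smul_assoc, add_add_add_comm, ← add_smul, hst,
        one_smul]
    rw [hD, Set.mem_ofPred_eq, he]
    exact this
  have hhol : DifferentiableOn ℂ (fun ξ : ℂ => g (a₀ + ξ • b₀)) D :=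
    (hfg.comp (fun ξ : ℂ => a₀ + ξ • b₀) (fun ξ h => h) hcont.continuousOn).differentiableOn
      (Eventually.of_forall fun k => (hf k).comp (by fun_prop) fun ξ h => h) hDo
  have hfreq : ∀ ξ₀ ∈ D, ∃ᶠ ξ in 𝓝 ξ₀, g (a₀ + ξ • b₀) ≠ g a₀ := by
    intro ξ₀ h₀ hev
    simp only [not_not] at hev
    have heq := (hhol.analyticOnNhd hDo).eqOn_of_preconnected_of_eventuallyEq
      (analyticOnNhd_const (v := g a₀)) hDc h₀ hev
    exact hne fun ζ ζ' h h' => (heq h).trans (heq h').symm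
  obtain ⟨s, hrs, hsR⟩ := exists_between hrR
  set K : Set ℂ := {ξ | a₀ + ξ • b₀ ∈ closedBall (0 : E) s} with hK
  have hKD : K ⊆ D := fun ξ h => closedBall_subset_ball hsR h
  have hnorm : ∀ {x y : E} {ξ : ℂ} {t : ℝ}, ‖y‖ = 1 → ‖x + ξ • y‖ ≤ t → ‖ξ‖ ≤ t + ‖x‖ := by
    intro x y ξ t hy h
    have := norm_sub_le (x + ξ • y) x
    rw [add_sub_cancel_left, norm_smul, hy, mul_one] at this
    linarith
  have hKc : IsCompact K := by
    refine Metric.isCompact_of_isClosed_isBounded (isClosed_closedBall.preimage hcont) ?_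
    refine (isBounded_closedBall (x := (0 : ℂ)) (r := s + ‖a₀‖)).subset fun ξ h => ?_
    exact mem_closedBall_zero_iff.2 (hnorm hb₀ (mem_closedBall_zero_iff.1 h))
  have hcover : ∀ᶠ k in atTop, ∀ ζ : ℂ, a k + ζ • b k ∈ ball 0 r → ζ ∈ K := by
    have hlim : Tendsto (fun k => ‖a₀ - a k‖ + (r + r) * ‖b₀ - b k‖) atTop (𝓝 0) := by
      have h1 := (ha.const_sub a₀).norm
      have h2 := (hb.const_sub b₀).norm
      simpa using h1.add (h2.const_mul (r + r))
    filter_upwards [hlim.eventually_lt_const (sub_pos.2 hrs)] with k hk ζ hζ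
    rw [mem_ball_zero_iff] at hζ
    have hak := mem_ball_zero_iff.1 (har k)
    have hζn : ‖ζ‖ ≤ r + r := (hnorm (hb1 k) hζ.le).trans (by linarith)
    refine mem_closedBall_zero_iff.2 ?_
    have he : a₀ + ζ • b₀ = (a k + ζ • b k) + ((a₀ - a k) + ζ • (b₀ - b k)) := by module
    rw [he]
    have h1 := norm_add_le (a k + ζ • b k) ((a₀ - a k) + ζ • (b₀ - b k))
    have h2 := norm_add_le (a₀ - a k) (ζ • (b₀ - b k))
    rw [norm_smul] at h2
    have h3 : ‖ζ‖ * ‖b₀ - b k‖ ≤ (r + r) * ‖b₀ - b k‖ := by gcongr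
    linarith
  obtain ⟨N, hN⟩ : ∃ N : ℕ, ∀ᶠ k in atTop, ∀ (S : Finset ℂ) (mul : ℂ → ℕ), (∀ ζ ∈ S, ζ ∈ K) →
      (∀ ζ ∈ S, (mul ζ : ℕ∞) ≤ analyticOrderAt (fun ξ => f k (a k + ξ • b k) - f k (a k)) ζ) →
      ∑ ζ ∈ S, mul ζ ≤ N := by
    refine hKc.induction_on ?_ ?_ ?_ ?_
    · refine ⟨0, Eventually.of_forall fun k S mul hS _ => ?_⟩
      simp [Finset.eq_empty_of_forall_notMem hS]
    · rintro s t hst ⟨N, hN⟩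
      exact ⟨N, hN.mono fun k h S mul hS => h S mul fun ζ hζ => hst (hS ζ hζ)⟩
    · classical
      rintro s t ⟨N, hN⟩ ⟨N', hN'⟩
      refine ⟨N + N', ?_⟩
      filter_upwards [hN, hN'] with k h h' S mul hS hmul
      rw [← Finset.sum_filter_add_sum_filter_not S (· ∈ s)]
      refine add_le_add (h _ mul (fun ζ hζ => (Finset.mem_filter.1 hζ).2)
        fun ζ hζ => hmul ζ (Finset.mem_filter.1 hζ).1) (h' _ mul (fun ζ hζ => ?_)
        fun ζ hζ => hmul ζ (Finset.mem_filter.1 hζ).1)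
      exact (hS ζ (Finset.mem_filter.1 hζ).1).resolve_left (Finset.mem_filter.1 hζ).2
    · intro ξ₀ hξ₀
      obtain ⟨V, hV, h⟩ := exists_nhds_eventually_sum_le isOpen_ball hf hfg ha hb hw (hKD hξ₀)
        (hfreq ξ₀ (hKD hξ₀))
      exact ⟨V, mem_nhdsWithin_of_mem_nhds hV, h⟩
  refine ⟨N, ?_⟩
  filter_upwards [hN, hcover] with k h hk S mul hS
  exact h S mul fun ζ hζ => hk ζ (hS ζ hζ)

/-- A function whose value is `w` and whose derivatives of orders `1, …, m - 1` vanish takes the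
value `w` to order at least `m`. -/
theorem natCast_le_analyticOrderAt_sub_const {φ : ℂ → ℂ} {w ζ : ℂ} {m : ℕ} (hφ : AnalyticAt ℂ φ ζ)
    (hw : φ ζ = w) (hd : ∀ j : ℕ, 1 ≤ j → j < m → iteratedDeriv j φ ζ = 0) :
    (m : ℕ∞) ≤ analyticOrderAt (fun ξ => φ ξ - w) ζ := by
  rw [natCast_le_analyticOrderAt_iff_iteratedDeriv_eq_zero (hφ.fun_sub analyticAt_const)]
  intro j hj
  rcases Nat.eq_zero_or_pos j with rfl | hpos
  · simp [hw]
  · rw [iteratedDeriv_fun_sub hφ.contDiffAt contDiffAt_const, hd j hpos hj, iteratedDeriv_const,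
      if_neg hpos.ne', sub_zero]

/-- A configuration of solutions along a line can be reparametrized so that the direction is a unit
vector and the base point is one of the solutions. -/
theorem exists_normalized_solutions {E : Type*} [NormedAddCommGroup E] [NormedSpace ℂ E]
    {R r : ℝ} (hrR : r < R) {f : E → ℂ} (hf : DifferentiableOn ℂ f (ball 0 R)) {a b : E}
    (hb : b ≠ 0) {w : ℂ} {S : Finset ℂ} {mul : ℂ → ℕ} (hS : S.Nonempty)
    (hball : ∀ ζ ∈ S, a + ζ • b ∈ ball (0 : E) r) (hw : ∀ ζ ∈ S, f (a + ζ • b) = w)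
    (hd : ∀ ζ ∈ S, ∀ j : ℕ, 1 ≤ j → j < mul ζ →
      iteratedDeriv j (fun ξ : ℂ => f (a + ξ • b)) ζ = 0) :
    ∃ (a' b' : E) (S' : Finset ℂ) (mul' : ℂ → ℕ), a' ∈ ball 0 r ∧ ‖b'‖ = 1 ∧
      (∀ ζ ∈ S', a' + ζ • b' ∈ ball (0 : E) r) ∧
      (∀ ζ ∈ S', (mul' ζ : ℕ∞) ≤ analyticOrderAt (fun ξ => f (a' + ξ • b') - f a') ζ) ∧
      ∑ ζ ∈ S', mul' ζ = ∑ ζ ∈ S, mul ζ := by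
  classical
  obtain ⟨ζ₀, hζ₀⟩ := hS
  have hb0 : (‖b‖ : ℂ) ≠ 0 := by simpa using hb
  set σ : ℂ → ℂ := fun ξ => ζ₀ + ξ * (‖b‖ : ℂ)⁻¹ with hσ
  set τ : ℂ → ℂ := fun ζ => (ζ - ζ₀) * (‖b‖ : ℂ) with hτ
  have hστ : ∀ ζ, σ (τ ζ) = ζ := fun ζ => by simp [hσ, hτ, hb0]
  have hpt : ∀ ξ : ℂ, (a + ζ₀ • b) + ξ • ((‖b‖ : ℂ)⁻¹ • b) = a + σ ξ • b := fun ξ => by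
    simp only [hσ]
    module
  have hσan : ∀ ξ, AnalyticAt ℂ σ ξ := fun ξ => by fun_prop
  have hσd : ∀ ξ, deriv σ ξ ≠ 0 := fun ξ => by simp [hσ, hb]
  have hopen : IsOpen {ξ : ℂ | a + ξ • b ∈ ball (0 : E) R} :=
    isOpen_ball.preimage (by fun_prop : Continuous fun ξ : ℂ => a + ξ • b)
  have hdiff : DifferentiableOn ℂ (fun ξ : ℂ => f (a + ξ • b)) {ξ : ℂ | a + ξ • b ∈ ball 0 R} :=
    hf.comp (by fun_prop) fun ξ h => h
  refine ⟨a + ζ₀ • b, (‖b‖ : ℂ)⁻¹ • b, S.image τ, mul ∘ σ, hball ζ₀ hζ₀, ?_, ?_, ?_, ?_⟩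
  · simp [norm_smul, hb]
  · simp only [Finset.forall_mem_image, hpt, hστ]
    exact hball
  · simp only [Finset.forall_mem_image, hpt, Function.comp_apply, hστ, hw ζ₀ hζ₀]
    intro ζ hζ
    have h := analyticOrderAt_comp_of_deriv_ne_zero (f := fun ξ => f (a + ξ • b) - w)
      (hσan (τ ζ)) (hσd (τ ζ))
    rw [hστ] at h
    change _ ≤ analyticOrderAt ((fun ξ => f (a + ξ • b) - w) ∘ σ) (τ ζ)
    rw [h]
    exact natCast_le_analyticOrderAt_sub_const
      (hdiff.analyticAt (hopen.mem_nhds (ball_subset_ball hrR.le (hball ζ hζ)))) (hw ζ hζ) (hd ζ hζ)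
  · rw [Finset.sum_image fun x _ y _ h => by rw [← hστ x, h, hστ]]
    simp [hστ]

/-- Lemma 9.3: uniform valency bound on a normal family `F` of holomorphic functions on the
ball `B_ℂ(0,R) ⊆ ℂⁿ`, none of whose locally uniform limit functions is constant along a
complex affine line meeting the ball.  The valency of `f` in `B_ℂ(0,r)` is encoded by
counting, along any parametrized complex line `ζ ↦ a + ζ • b` (`b ≠ 0`), finite sets of
distinct solutions of `f = w` in `B_ℂ(0,r)` together with multiplicities witnessed by the
vanishing of the derivatives of the one-variable restriction. -/
theorem stmt10 (n : ℕ) (hn : 1 ≤ n) (R r : ℝ) (hr : 1 < r) (hRr : r < R)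
    (F : Set ((EuclideanSpace ℂ (Fin n)) → ℂ))
    (hF_hol : ∀ f ∈ F, DifferentiableOn ℂ f (ball (0 : EuclideanSpace ℂ (Fin n)) R))
    (hF_normal : ∀ u : ℕ → (EuclideanSpace ℂ (Fin n)) → ℂ, (∀ k, u k ∈ F) →
      ∃ φ : ℕ → ℕ, StrictMono φ ∧ ∃ g : (EuclideanSpace ℂ (Fin n)) → ℂ,
        TendstoLocallyUniformlyOn (fun k => u (φ k)) g atTop
          (ball (0 : EuclideanSpace ℂ (Fin n)) R))
    (hF_nonconst : ∀ g : (EuclideanSpace ℂ (Fin n)) → ℂ,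
      (g ∈ F ∨ ∃ u : ℕ → (EuclideanSpace ℂ (Fin n)) → ℂ, (∀ k, u k ∈ F) ∧
        TendstoLocallyUniformlyOn u g atTop (ball (0 : EuclideanSpace ℂ (Fin n)) R)) →
      ∀ a b : EuclideanSpace ℂ (Fin n), b ≠ 0 →
        (∃ ζ : ℂ, a + ζ • b ∈ ball (0 : EuclideanSpace ℂ (Fin n)) R) →
        ¬ (∀ ζ ζ' : ℂ, a + ζ • b ∈ ball (0 : EuclideanSpace ℂ (Fin n)) R →
            a + ζ' • b ∈ ball (0 : EuclideanSpace ℂ (Fin n)) R →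
            g (a + ζ • b) = g (a + ζ' • b))) :
    ∃ N : ℕ, ∀ f ∈ F, ∀ a b : EuclideanSpace ℂ (Fin n), b ≠ 0 →
      ∀ w : ℂ, ∀ S : Finset ℂ, ∀ mul : ℂ → ℕ,
        (∀ ζ ∈ S, a + ζ • b ∈ ball (0 : EuclideanSpace ℂ (Fin n)) r) →
        (∀ ζ ∈ S, f (a + ζ • b) = w) →
        (∀ ζ ∈ S, ∀ j : ℕ, 1 ≤ j → j < mul ζ →
          iteratedDeriv j (fun ξ : ℂ => f (a + ξ • b)) ζ = 0) →
        (∑ ζ ∈ S, mul ζ) ≤ N := by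
  by_contra! hcon
  have hnorm : ∀ N : ℕ, ∃ f ∈ F, ∃ (a b : EuclideanSpace ℂ (Fin n)) (S : Finset ℂ) (mul : ℂ → ℕ),
      a ∈ ball 0 r ∧ ‖b‖ = 1 ∧ (∀ ζ ∈ S, a + ζ • b ∈ ball 0 r) ∧
      (∀ ζ ∈ S, (mul ζ : ℕ∞) ≤ analyticOrderAt (fun ξ => f (a + ξ • b) - f a) ζ) ∧
      N < ∑ ζ ∈ S, mul ζ := by
    intro N
    obtain ⟨f, hf, a, b, hb, w, S, mul, hball, hw, hd, hlt⟩ := hcon N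
    have hS : S.Nonempty := by
      rw [Finset.nonempty_iff_ne_empty]
      rintro rfl
      simp at hlt
    obtain ⟨a', b', S', mul', ha', hb', hball', hord', hsum⟩ :=
      exists_normalized_solutions hRr (hF_hol f hf) hb hS hball hw hd
    exact ⟨f, hf, a', b', S', mul', ha', hb', hball', hord', hsum ▸ hlt⟩
  choose f hf a b S mul ha hb hball hord hlt using hnorm
  obtain ⟨φ, hφ, g, hg⟩ := hF_normal f hf
  obtain ⟨⟨a₀, b₀⟩, hab₀, ψ, hψ, hlim⟩ :=
    ((isCompact_closedBall (0 : EuclideanSpace ℂ (Fin n)) r).prod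
      (isCompact_sphere (0 : EuclideanSpace ℂ (Fin n)) 1)).tendsto_subseq
      (x := fun k => (a (φ k), b (φ k)))
      fun k => ⟨ball_subset_closedBall (ha _), mem_sphere_zero_iff_norm.2 (hb _)⟩
  have hg' : TendstoLocallyUniformlyOn (fun k => f (φ (ψ k))) g atTop (ball 0 R) := by
    intro u hu x hx
    obtain ⟨t, ht, h⟩ := hg u hu x hx
    exact ⟨t, ht, hψ.tendsto_atTop.eventually h⟩
  have hb₀ : b₀ ≠ 0 := ne_zero_of_mem_unit_sphere ⟨b₀, hab₀.2⟩
  have hne := hF_nonconst g (Or.inr ⟨_, fun k => hf _, hg'⟩) a₀ b₀ hb₀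
    ⟨0, by simpa using closedBall_subset_ball hRr hab₀.1⟩
  obtain ⟨N, hN⟩ := exists_eventually_sum_le hRr (fun k => hF_hol _ (hf (φ (ψ k)))) hg'
    ((continuous_fst.tendsto _).comp hlim) ((continuous_snd.tendsto _).comp hlim)
    (fun k => ha _) (fun k => hb _) hne
  obtain ⟨k, hk, hNk⟩ := (hN.and (eventually_ge_atTop N)).exists
  have h1 := hk (S (φ (ψ k))) (mul (φ (ψ k))) (hball _) (hord _)
  have h2 := hlt (φ (ψ k))
  have h3 := hφ.le_apply (x := ψ k)
  have h4 := hψ.le_apply (x := k)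
  omega
end
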